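/- Let φ ∈ 𝒬(R) and λ₀ ∈ 𝔞*(P,R) ∩ E. Then the Fourier inversion formula φ(λ) = (2π)^{-d} ∫_E e^{-⟨λ,x⟩} f_{λ₀}(x) dx holds for every λ ∈ 𝔞*(P,R), the integral converging absolutely. -/

import Mathlib

noncomputable section

open Complex Real

/-- ℂ^d with the Euclidean norm. -/
abbrev Cd (d : ℕ) := EuclideanSpace ℂ (Fin d)
/-- ℝ^d with the Euclidean norm. -/
abbrev Ed (d : ℕ) := EuclideanSpace ℝ (Fin d)

/-- Componentwise real part. -/
def rePart (d : ℕ) (l : Cd d) : Ed d := WithLp.toLp 2 fun j => (l j).re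

/-- Inclusion of ℝ^d into ℂ^d. -/
def toC (d : ℕ) (x : Ed d) : Cd d := WithLp.toLp 2 fun j => (x j : ℂ)

/-- The tube 𝔞*(P,R). -/
def aStar (d : ℕ) (Sp : Finset (Ed d)) (R : ℝ) : Set (Cd d) :=
  {l | ∀ α ∈ Sp, (∑ j, (l j).re * α j) < R}

/-- The seminorm ν_{ω,n}. -/
def nu (d : ℕ) (ω : Set (Ed d)) (n : ℕ) (φ : Cd d → ℂ) : ℝ :=
  sSup {r : ℝ | ∃ l : Cd d, rePart d l ∈ ω ∧ r = (1 + ‖l‖) ^ n * ‖φ l‖}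

/-- Membership in 𝒬(R). -/
def memQ (d : ℕ) (Sp : Finset (Ed d)) (R : ℝ) (φ : Cd d → ℂ) : Prop :=
  DifferentiableOn ℂ φ (aStar d Sp R) ∧
  ∀ (n : ℕ) (ω : Set (Ed d)), Bornology.IsBounded ω → toC d '' ω ⊆ aStar d Sp R →
    ∃ C : ℝ, ∀ l : Cd d, rePart d l ∈ ω → (1 + ‖l‖) ^ n * ‖φ l‖ ≤ C

/-- Strictly antidominant. -/
def Antidom (d : ℕ) (Sp : Finset (Ed d)) (η : Ed d) : Prop :=
  ∀ α ∈ Sp, (∑ j, η j * α j) < 0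

/-- Membership in 𝒬_M(R). -/
def memQM (d : ℕ) (Sp : Finset (Ed d)) (R M : ℝ) (φ : Cd d → ℂ) : Prop :=
  memQ d Sp R φ ∧
  ∀ η : Ed d, Antidom d Sp η →
    ∃ tη Cη : ℝ, 0 < tη ∧ 0 < Cη ∧
      ∀ t : ℝ, tη ≤ t → ∀ l : Cd d, rePart d l = t • η →
        ‖φ l‖ ≤
          Cη * (1 + ‖l‖) ^ (-(d : ℝ) - 1) * Real.exp (M * ‖rePart d l‖)

/-- The point λ₀ + iξ of ℂ^d, for λ₀, ξ ∈ ℝ^d. -/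
def shift (d : ℕ) (lam0 ξ : Ed d) : Cd d := WithLp.toLp 2 fun j => (lam0 j : ℂ) + Complex.I * (ξ j : ℂ)

/-- The function f_{λ₀}(x) = ∫_E e^{⟨λ₀+iξ,x⟩} φ(λ₀+iξ) dξ. -/
def fLam (d : ℕ) (φ : Cd d → ℂ) (lam0 : Ed d) (x : Ed d) : ℂ :=
  ∫ ξ : Ed d, Complex.exp (∑ j, shift d lam0 ξ j * (x j : ℂ)) * φ (shift d lam0 ξ)

open MeasureTheory Filter Topology Metric

lemma differentiableAt_integral_of_bound {X : Type*} [MeasurableSpace X] {μ : Measure X}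
    (G : ℂ → X → ℂ) (b : X → ℝ) (s0 : ℂ) (ρ : ℝ) (hρ : 0 < ρ)
    (hm : ∀ s ∈ ball s0 ρ, AEStronglyMeasurable (G s) μ)
    (hd : ∀ x, DifferentiableOn ℂ (fun s => G s x) (ball s0 ρ))
    (hb : ∀ s ∈ ball s0 ρ, ∀ x, ‖G s x‖ ≤ b x) (hbi : Integrable b μ) :
    DifferentiableAt ℂ (fun s => ∫ x, G s x ∂μ) s0 := by
  have h0 : s0 ∈ ball s0 ρ := mem_ball_self hρ
  have hat : ∀ s ∈ ball s0 ρ, ∀ x, HasDerivAt (fun s => G s x) (deriv (fun s => G s x) s) s := by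
    intro s hs x
    exact ((hd x).differentiableAt (isOpen_ball.mem_nhds hs)).hasDerivAt
  refine (hasDerivAt_integral_of_dominated_loc_of_deriv_le (μ := μ) (F := G)
    (F' := fun s x => deriv (fun s => G s x) s) (bound := fun x => b x / (ρ / 4))
    (s := ball s0 (ρ/2)) (ball_mem_nhds _ (by positivity)) ?_ ?_ ?_ ?_ ?_ ?_).2.differentiableAt
  · filter_upwards [isOpen_ball.mem_nhds h0] with s hs using hm s hs
  · exact hbi.mono' (hm s0 h0) (ae_of_all _ (hb s0 h0))
  · let u : ℕ → ℂ := fun n => ((ρ / 2 * (1 / ((n:ℝ) + 1)) : ℝ) : ℂ)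
    have hu0 : ∀ n, u n ≠ 0 := by
      intro n; simp only [u]; norm_cast; positivity
    have hub : ∀ n, s0 + u n ∈ ball s0 ρ := by
      intro n
      have h1 : 1 / ((n:ℝ) + 1) ≤ 1 := by
        rw [div_le_one (by positivity)]; linarith [Nat.cast_nonneg (α := ℝ) n]
      have h2 : 0 < 1 / ((n:ℝ) + 1) := by positivity
      simp only [u, mem_ball, dist_self_add_left, Complex.norm_real, Real.norm_eq_abs]
      rw [abs_of_pos (by positivity)]
      nlinarith
    have hut : Tendsto u atTop (𝓝[≠] 0) := by
      rw [tendsto_nhdsWithin_iff]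
      refine ⟨?_, Eventually.of_forall hu0⟩
      have := (tendsto_one_div_add_atTop_nhds_zero_nat (𝕜 := ℝ)).const_mul (ρ/2)
      rw [mul_zero] at this
      have h2 := (Complex.continuous_ofReal.tendsto 0).comp this
      rw [Complex.ofReal_zero] at h2
      exact h2
    refine aestronglyMeasurable_of_tendsto_ae atTop
      (f := fun n x => (u n)⁻¹ • (G (s0 + u n) x - G s0 x)) ?_ ?_
    · intro n
      exact ((hm _ (hub n)).sub (hm _ h0)).const_smul (u n)⁻¹
    · refine ae_of_all _ fun x => ?_
      exact ((hasDerivAt_iff_tendsto_slope_zero.1 (hat s0 h0 x))).comp hut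
  · refine ae_of_all _ fun x s hs => ?_
    have hsub : closedBall s (ρ/4) ⊆ ball s0 ρ := by
      intro z hz
      rw [mem_ball] at *
      rw [mem_closedBall] at hz
      linarith [dist_triangle z s s0]
    refine Complex.norm_deriv_le_of_forall_mem_sphere_norm_le (by positivity) ?_ ?_
    · exact ((hd x).mono hsub).diffContOnCl_ball subset_rfl
    · intro z hz
      exact hb z (hsub (sphere_subset_closedBall hz)) x
  · exact hbi.div_const _
  · refine ae_of_all _ fun x s hs => ?_
    exact hat s (ball_subset_ball (by linarith) hs) x

/-- Imaginary part. -/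
def imP (d : ℕ) (l : Cd d) : Ed d := WithLp.toLp 2 fun j => (l j).im

lemma imP_norm_le (d : ℕ) (l : Cd d) : ‖imP d l‖ ≤ ‖l‖ := by
  rw [EuclideanSpace.norm_eq, EuclideanSpace.norm_eq]
  apply Real.sqrt_le_sqrt
  refine Finset.sum_le_sum fun j _ => ?_
  have : ‖(imP d l) j‖ ≤ ‖l j‖ := by
    simpa [imP] using Complex.abs_im_le_norm (l j)
  gcongr

@[simp] lemma rePart_shift (d : ℕ) (a b : Ed d) : rePart d (shift d a b) = a := by
  ext j; simp [rePart, shift]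

@[simp] lemma imP_shift (d : ℕ) (a b : Ed d) : imP d (shift d a b) = b := by
  ext j; simp [imP, shift]

lemma shift_re_im (d : ℕ) (l : Cd d) : shift d (rePart d l) (imP d l) = l := by
  ext j
  simp only [rePart, shift, imP]
  rw [mul_comm]; exact Complex.re_add_im _

lemma continuous_shift (d : ℕ) (a : Ed d) : Continuous (shift d a) := by
  unfold shift
  fun_prop

/-- base of the tube -/
def baseSet (d : ℕ) (Sp : Finset (Ed d)) (R : ℝ) : Set (Ed d) :=
  {l | ∀ α ∈ Sp, (∑ j, l j * α j) < R}

lemma mem_aStar_iff {d : ℕ} {Sp : Finset (Ed d)} {R : ℝ} {l : Cd d} :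
    l ∈ aStar d Sp R ↔ rePart d l ∈ baseSet d Sp R := Iff.rfl

lemma toC_mem_iff {d : ℕ} {Sp : Finset (Ed d)} {R : ℝ} {a : Ed d} :
    toC d a ∈ aStar d Sp R ↔ a ∈ baseSet d Sp R := by
  simp [aStar, baseSet, toC]

lemma isOpen_base (d : ℕ) (Sp : Finset (Ed d)) (R : ℝ) : IsOpen (baseSet d Sp R) := by
  have : baseSet d Sp R = ⋂ α ∈ Sp, {l : Ed d | (∑ j, l j * α j) < R} := by
    ext; simp [baseSet]
  rw [this]
  refine isOpen_biInter_finset fun α _ => isOpen_lt (by fun_prop) continuous_const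

lemma convex_base (d : ℕ) (Sp : Finset (Ed d)) (R : ℝ) : Convex ℝ (baseSet d Sp R) := by
  intro x hx y hy a b ha hb hab α hα
  have h1 := hx α hα
  have h2 := hy α hα
  have : (∑ j, (a • x + b • y) j * α j) = a * (∑ j, x j * α j) + b * (∑ j, y j * α j) := by
    rw [Finset.mul_sum, Finset.mul_sum, ← Finset.sum_add_distrib]
    refine Finset.sum_congr rfl fun j _ => ?_
    simp; ring
  rw [this]
  rcases ha.eq_or_lt with h | h
  · subst h
    have : b = 1 := by linarith
    subst this; simpa using h2
  · have : R = a * R + b * R := by rw [← add_mul, hab, one_mul]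
    rw [this]
    have := mul_lt_mul_of_pos_left h1 h
    have := mul_le_mul_of_nonneg_left h2.le hb
    linarith

lemma isOpen_aStar (d : ℕ) (Sp : Finset (Ed d)) (R : ℝ) : IsOpen (aStar d Sp R) := by
  have : Continuous (rePart d) := by unfold rePart; fun_prop
  exact (isOpen_base d Sp R).preimage this

/-- uniform decay -/
lemma decay {d : ℕ} {Sp : Finset (Ed d)} {R : ℝ} {φ : Cd d → ℂ} (hφ : memQ d Sp R φ)
    {ω : Set (Ed d)} (hb : Bornology.IsBounded ω) (hω : ω ⊆ baseSet d Sp R) :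
    ∃ C : ℝ, 0 ≤ C ∧ ∀ a ∈ ω, ∀ ξ, ‖φ (shift d a ξ)‖ ≤ C * (1 + ‖ξ‖) ^ (-((d:ℝ) + 1)) := by
  obtain ⟨C, hC⟩ := hφ.2 (d+1) ω hb (by
    rintro _ ⟨a, ha, rfl⟩; exact toC_mem_iff.2 (hω ha))
  refine ⟨max C 0, le_max_right _ _, fun a ha ξ => ?_⟩
  have h1 := hC (shift d a ξ) (by simpa using ha)
  have h2 : ‖ξ‖ ≤ ‖shift d a ξ‖ := by simpa using imP_norm_le d (shift d a ξ)
  have h3 : (1 + ‖ξ‖) ^ (-((d:ℝ) + 1)) = ((1 + ‖ξ‖) ^ (d+1))⁻¹ := by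
    rw [Real.rpow_neg (by positivity)]; norm_cast
  rw [h3, ← div_eq_mul_inv, le_div_iff₀ (by positivity), mul_comm]
  refine le_trans ?_ (h1.trans (le_max_left _ _))
  gcongr

lemma integrable_base (d : ℕ) : Integrable (fun ξ : Ed d => (1 + ‖ξ‖) ^ (-((d:ℝ) + 1))) :=
  integrable_one_add_norm (by simp)

lemma fLam_shift_eq {d : ℕ} (φ : Cd d → ℂ) (a x : Ed d) :
    fLam d φ a x = Complex.exp ((∑ j, a j * x j : ℝ)) *
      ∫ ξ : Ed d, Complex.exp (Complex.I * (∑ j, ξ j * x j : ℝ)) * φ (shift d a ξ) := by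
  rw [fLam, ← integral_const_mul]
  congr 1 with ξ
  rw [← mul_assoc, ← Complex.exp_add]
  congr 2
  push_cast
  rw [Finset.mul_sum, ← Finset.sum_add_distrib]
  refine Finset.sum_congr rfl fun j _ => ?_
  simp [shift]; ring

lemma cont_slice {d : ℕ} {Sp : Finset (Ed d)} {R : ℝ} {φ : Cd d → ℂ} (hφ : memQ d Sp R φ)
    {a : Ed d} (ha : a ∈ baseSet d Sp R) : Continuous (fun ξ => φ (shift d a ξ)) := by
  have := hφ.1.continuousOn.comp_continuous (continuous_shift d a)
    (fun ξ => by rw [mem_aStar_iff]; simpa using ha)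
  exact this

/-- points of the complex line family -/
def pt (d : ℕ) (a v : Ed d) (s : ℂ) (ξ : Ed d) : Cd d := shift d a ξ + s • toC d v

lemma pt_eq (d : ℕ) (a v : Ed d) (s : ℂ) (ξ : Ed d) :
    pt d a v s ξ = shift d (a + s.re • v) (ξ + s.im • v) := by
  ext j
  apply Complex.ext <;> simp [pt, shift, toC]

lemma fLam_indep {d : ℕ} {Sp : Finset (Ed d)} {R : ℝ} {φ : Cd d → ℂ} (hφ : memQ d Sp R φ)
    {a b : Ed d} (ha : a ∈ baseSet d Sp R) (hb : b ∈ baseSet d Sp R) (x : Ed d) :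
    fLam d φ a x = fLam d φ b x := by
  set v := b - a with hv
  let e : Cd d → ℂ := fun z => Complex.exp (∑ j, z j * (x j : ℂ))
  let F : ℂ → ℂ := fun s => ∫ ξ : Ed d, e (pt d a v s ξ) * φ (pt d a v s ξ)
  let S : Set ℂ := {s | a + s.re • v ∈ baseSet d Sp R}
  have hFf : ∀ s, F s = fLam d φ (a + s.re • v) x := by
    intro s
    simp only [F, pt_eq]
    exact integral_add_right_eq_self
      (fun ξ => e (shift d (a + s.re • v) ξ) * φ (shift d (a + s.re • v) ξ)) (s.im • v)
  have hSo : IsOpen S := (isOpen_base d Sp R).preimage (by fun_prop)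
  have hSc : Convex ℝ S := by
    intro s hs t ht p q hp hq hpq
    have := convex_base d Sp R hs ht hp hq hpq
    simp only [S, Set.mem_ofPred_eq]
    convert this using 1
    have : a = (p + q) • a := by rw [hpq, one_smul]
    nth_rewrite 1 [this]
    simp only [Complex.add_re, Complex.real_smul, Complex.mul_re, Complex.ofReal_re,
      Complex.ofReal_im, zero_mul, sub_zero]
    module
  have he : Differentiable ℂ e := by simp only [e]; fun_prop
  have hecont : Continuous e := he.continuous
  have hen : ∀ a ξ, ‖e (shift d a ξ)‖ = Real.exp (∑ j, a j * x j) := by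
    intro a ξ
    simp only [e, Complex.norm_exp]
    congr 1
    simp [shift]
  have hdiff : ∀ s ∈ S, DifferentiableAt ℂ F s := by
    intro s0 hs0
    obtain ⟨ρ, hρ, hρS⟩ := Metric.isOpen_iff.1 hSo s0 hs0
    obtain ⟨ρ, hρ, hρS⟩ : ∃ r > 0, closedBall s0 r ⊆ S :=
      ⟨ρ/2, by positivity, (closedBall_subset_ball (by linarith)).trans hρS⟩
    let ω : Set (Ed d) := (fun s : ℂ => a + s.re • v) '' closedBall s0 ρ
    have hωc : IsCompact ω := (isCompact_closedBall s0 ρ).image (by fun_prop)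
    have hω : ω ⊆ baseSet d Sp R := by
      rintro _ ⟨s, hs, rfl⟩; exact hρS hs
    obtain ⟨C, hC0, hC⟩ := decay hφ hωc.isBounded hω
    obtain ⟨M, hM⟩ := hωc.exists_bound_of_continuousOn
      (f := fun a : Ed d => Real.exp (∑ j, a j * x j)) (by fun_prop)
    have hM0 : 0 ≤ M := (norm_nonneg _).trans (hM _ ⟨s0, mem_closedBall_self hρ.le, rfl⟩)
    let K : ℝ := (‖s0‖ + ρ) * ‖v‖
    have hK : 0 ≤ K := by positivity
    refine differentiableAt_integral_of_bound
      (fun s ξ => e (pt d a v s ξ) * φ (pt d a v s ξ))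
      (fun ξ => M * (C * (1 + K) ^ ((d:ℝ)+1)) * (1 + ‖ξ‖) ^ (-((d:ℝ) + 1))) s0 ρ hρ ?_ ?_ ?_ ?_
    · intro s hs
      have h1 := cont_slice hφ (hρS (ball_subset_closedBall hs))
      have h2 : Continuous (fun ξ => e (shift d (a + s.re • v) ξ)) :=
        hecont.comp (continuous_shift d _)
      have h3 := (h2.mul h1).comp (continuous_add_const (s.im • v))
      simp only [pt_eq]
      exact h3.aestronglyMeasurable
    · intro ξ s hs
      have h1 : DifferentiableAt ℂ φ (pt d a v s ξ) := by
        refine hφ.1.differentiableAt ((isOpen_aStar d Sp R).mem_nhds ?_)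
        rw [mem_aStar_iff, pt_eq, rePart_shift]
        exact hρS (ball_subset_closedBall hs)
      have h2 : DifferentiableAt ℂ (fun s => pt d a v s ξ) s := by
        unfold pt; fun_prop
      exact (((he _).comp s h2).mul (h1.comp s h2)).differentiableWithinAt
    · intro s hs ξ
      have hs' := ball_subset_closedBall hs
      have hmem : a + s.re • v ∈ ω := ⟨s, hs', rfl⟩
      rw [norm_mul, pt_eq, hen, mul_assoc]
      refine mul_le_mul ((le_abs_self _).trans (hM _ hmem)) ?_ (norm_nonneg _) hM0
      refine (hC _ hmem _).trans ?_
      rw [mul_assoc]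
      refine mul_le_mul_of_nonneg_left ?_ hC0
      rw [Real.rpow_neg (by positivity), Real.rpow_neg (by positivity), ← div_eq_mul_inv,
        inv_eq_one_div, div_le_div_iff₀ (by positivity) (by positivity), one_mul,
        ← Real.mul_rpow (by positivity) (by positivity)]
      refine Real.rpow_le_rpow (by positivity) ?_ (by positivity)
      have h1 : ‖ξ‖ ≤ ‖ξ + s.im • v‖ + ‖s.im • v‖ := by
        simpa using norm_sub_le (ξ + s.im • v) (s.im • v)
      have h2 : ‖s.im • v‖ ≤ K := by
        rw [norm_smul]
        refine mul_le_mul_of_nonneg_right ?_ (norm_nonneg _)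
        have h3 : ‖s‖ ≤ ‖s0‖ + ρ := by
          have := norm_sub_norm_le s s0
          rw [mem_closedBall, dist_eq_norm] at hs'
          linarith
        exact (Complex.abs_im_le_norm s).trans h3
      nlinarith [norm_nonneg (ξ + s.im • v)]
    · exact (integrable_base d).const_mul _
  have hder : ∀ s ∈ S, deriv F s = 0 := by
    intro s hs
    have h1 := (hdiff s hs).hasDerivAt
    have h2 : HasDerivAt (fun t : ℝ => s + (t:ℂ) * Complex.I) Complex.I 0 := by
      have := ((Complex.ofRealCLM.hasDerivAt (x := (0:ℝ))).mul_const Complex.I).const_add s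
      simpa using this
    have h3 : HasDerivAt (fun t : ℝ => F (s + (t:ℂ) * Complex.I)) (deriv F s * Complex.I) 0 := by
      have h1' : HasDerivAt F (deriv F s) (s + ((0:ℝ):ℂ) * Complex.I) := by simpa using h1
      exact h1'.comp (0:ℝ) h2
    have h4 : (fun t : ℝ => F (s + (t:ℂ) * Complex.I)) = fun _ => F s := by
      ext t
      rw [hFf, hFf]; simp
    rw [h4] at h3
    have := h3.unique (hasDerivAt_const _ _)
    simpa using this
  obtain ⟨c, hc⟩ := hSo.exists_is_const_of_deriv_eq_zero hSc.isPreconnected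
    (fun s hs => (hdiff s hs).differentiableWithinAt) (fun s hs => hder s hs)
  have h0 := hc 0 (by simpa [S] using ha)
  have h1 := hc 1 (by simpa [S, hv] using hb)
  rw [hFf] at h0 h1
  simp [hv] at h0 h1
  rw [h0, h1]

lemma integrable_exp_neg_norm (d : ℕ) (r : ℝ) (hr : 0 < r) :
    Integrable (fun x : Ed d => Real.exp (-(r * ‖x‖))) := by
  let n : ℝ := (d:ℝ) + 1
  have hn : 0 < n := by positivity
  let c : ℝ := min 1 (r / n)
  have hc : 0 < c := lt_min one_pos (by positivity)
  refine ((integrable_base d).const_mul ((c ^ n)⁻¹)).mono' (by fun_prop) (ae_of_all _ fun x => ?_)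
  rw [Real.norm_eq_abs, abs_of_pos (Real.exp_pos _), Real.exp_neg, Real.rpow_neg (by positivity),
    ← mul_inv, ← Real.mul_rpow hc.le (by positivity)]
  refine inv_anti₀ (by positivity) ?_
  have h1 : Real.exp (r * ‖x‖) = Real.exp (r * ‖x‖ / n) ^ n := by
    rw [← Real.exp_mul]; congr 1; field_simp
  rw [h1]
  refine Real.rpow_le_rpow (by positivity) ?_ hn.le
  refine le_trans ?_ (Real.add_one_le_exp _)
  have h2 : c ≤ 1 := min_le_left _ _
  have h3 : c ≤ r / n := min_le_right _ _
  have h4 : r * ‖x‖ / n = r / n * ‖x‖ := by ring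
  rw [h4]
  nlinarith [norm_nonneg x]

/-- exponential decay -/
lemma fLam_bound {d : ℕ} {Sp : Finset (Ed d)} {R : ℝ} {φ : Cd d → ℂ} (hφ : memQ d Sp R φ)
    {a b : Ed d} (ha : a ∈ baseSet d Sp R) (hb : b ∈ baseSet d Sp R) :
    ∃ C r : ℝ, 0 < r ∧ ∀ x, Real.exp (-∑ j, b j * x j) * ‖fLam d φ a x‖
      ≤ C * Real.exp (-(r * ‖x‖)) := by
  obtain ⟨ρ, hρ, hsub⟩ := Metric.isOpen_iff.1 (isOpen_base d Sp R) b hb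
  have hsub : closedBall b (ρ/2) ⊆ baseSet d Sp R :=
    (closedBall_subset_ball (by linarith)).trans hsub
  obtain ⟨C, hC0, hC⟩ := decay hφ isBounded_closedBall hsub
  refine ⟨∫ ξ : Ed d, C * (1 + ‖ξ‖) ^ (-((d:ℝ) + 1)), ρ/2, by positivity, fun x => ?_⟩
  let b' : Ed d := b - (ρ/2) • (‖x‖⁻¹ • x)
  have hb' : b' ∈ closedBall b (ρ/2) := by
    rw [mem_closedBall, dist_eq_norm]
    simp only [b', sub_sub_cancel_left, norm_neg, norm_smul, norm_inv, norm_norm]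
    rw [Real.norm_eq_abs, abs_of_pos (by positivity)]
    have : ‖x‖⁻¹ * ‖x‖ ≤ 1 := inv_mul_le_one
    nlinarith
  have hsum : ∑ j, b' j * x j = (∑ j, b j * x j) - ρ/2 * ‖x‖ := by
    have h1 : ∑ j, x j * x j = ‖x‖ ^ 2 := by
      rw [EuclideanSpace.real_norm_sq_eq]
      exact Finset.sum_congr rfl fun j _ => by ring
    have h2 : ‖x‖⁻¹ * ‖x‖ ^ 2 = ‖x‖ := by
      by_cases h : ‖x‖ = 0
      · simp [h]
      · field_simp
    calc ∑ j, b' j * x j = ∑ j, (b j * x j - (ρ/2 * ‖x‖⁻¹) * (x j * x j)) :=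
          Finset.sum_congr rfl fun j _ => by simp [b']; ring
      _ = _ := by rw [Finset.sum_sub_distrib, ← Finset.mul_sum, h1, mul_assoc, h2]
  rw [fLam_indep hφ ha (hsub hb'), fLam_shift_eq, norm_mul, ← mul_assoc, Complex.norm_exp,
    Complex.ofReal_re, hsum, ← Real.exp_add, mul_comm]
  have h1 : -∑ j, b j * x j + ((∑ j, b j * x j) - ρ/2 * ‖x‖) = -(ρ/2 * ‖x‖) := by ring
  rw [h1]
  refine mul_le_mul_of_nonneg_right ?_ (Real.exp_pos _).le
  refine norm_integral_le_of_norm_le ((integrable_base d).const_mul _) (ae_of_all _ fun ξ => ?_)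
  rw [norm_mul, mul_comm Complex.I, Complex.norm_exp_ofReal_mul_I, one_mul]
  exact hC _ hb' ξ

open FourierTransform

/-- The Fourier inversion formula
φ(λ) = (2π)^{-d} ∫_E e^{-⟨λ,x⟩} f_{λ₀}(x) dx, valid on all of 𝔞*(P,R). -/
theorem fourier_inversion_for_Q
    (d : ℕ) (hd : 1 ≤ d) (Sp : Finset (Ed d)) (hSp : (0 : Ed d) ∉ Sp) (R : ℝ)
    (φ : Cd d → ℂ) (hφ : memQ d Sp R φ)
    (lam0 : Ed d) (hlam0 : toC d lam0 ∈ aStar d Sp R)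
    (l : Cd d) (hl : l ∈ aStar d Sp R) :
    MeasureTheory.Integrable
      (fun x : Ed d => Complex.exp (-∑ j, l j * (x j : ℂ)) * fLam d φ lam0 x) ∧
    φ l = (2 * Real.pi : ℂ) ^ (-(d : ℤ)) *
      ∫ x : Ed d, Complex.exp (-∑ j, l j * (x j : ℂ)) * fLam d φ lam0 x := by
  rw [toC_mem_iff] at hlam0
  rw [mem_aStar_iff] at hl
  set b := rePart d l with hbdef
  set η := imP d l with hη
  let g : Ed d → ℂ := fun ξ => φ (shift d b ξ)
  have hgc : Continuous g := cont_slice hφ hl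
  have hgi : Integrable g := by
    obtain ⟨C, hC0, hC⟩ := decay hφ (ω := {b}) Bornology.isBounded_singleton (by simpa using hl)
    exact ((integrable_base d).const_mul C).mono' hgc.aestronglyMeasurable
      (ae_of_all _ fun ξ => hC b rfl ξ)
  have hfour : ∀ x, fLam d φ lam0 x
      = Complex.exp ((∑ j, b j * x j : ℝ)) * 𝓕⁻ g ((2 * Real.pi)⁻¹ • x) := by
    intro x
    rw [fLam_indep hφ hlam0 hl, fLam_shift_eq, Real.fourierInv_eq']
    congr 2 with ξ
    rw [smul_eq_mul]
    congr 2
    rw [real_inner_smul_right, mul_comm Complex.I]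
    congr 2
    rw [PiLp.inner_apply]
    have : (2 * Real.pi) ≠ 0 := by positivity
    rw [mul_inv_cancel_left₀ this]
    exact Finset.sum_congr rfl fun j _ => by simp [mul_comm]
  have hexp : ∀ x : Ed d, Complex.exp (-∑ j, l j * (x j : ℂ))
      = Complex.exp (-(∑ j, b j * x j : ℝ)) * Complex.exp (-((∑ j, x j * η j : ℝ) * Complex.I)) := by
    intro x
    rw [← Complex.exp_add]
    congr 1
    rw [← neg_add]
    congr 1
    push_cast
    rw [Finset.sum_mul, ← Finset.sum_add_distrib]
    refine Finset.sum_congr rfl fun j _ => ?_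
    have hj : l j = (b j : ℂ) + (η j : ℂ) * Complex.I := (Complex.re_add_im (l j)).symm
    rw [hj]; ring
  have hint : ∀ x : Ed d, Complex.exp (-∑ j, l j * (x j : ℂ)) * fLam d φ lam0 x
      = (fun y : Ed d => Complex.exp (((-2 * Real.pi * inner ℝ y η : ℝ) : ℂ) * Complex.I) • 𝓕⁻ g y)
        ((2 * Real.pi)⁻¹ • x) := by
    intro x
    have hpi : (2 * Real.pi) ≠ 0 := by positivity
    have h0 : Complex.exp (-(∑ j, b j * x j : ℝ)) * Complex.exp ((∑ j, b j * x j : ℝ)) = 1 := by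
      rw [← Complex.exp_add]; simp
    have h1 : ((-2 * Real.pi * inner ℝ ((2 * Real.pi)⁻¹ • x) η : ℝ) : ℂ) * Complex.I
        = -((∑ j, x j * η j : ℝ) * Complex.I) := by
      rw [← neg_mul, ← Complex.ofReal_neg]
      congr 2
      rw [real_inner_smul_left, neg_mul, neg_mul, mul_inv_cancel_left₀ hpi, PiLp.inner_apply]
      congr 1
      exact Finset.sum_congr rfl fun j _ => by simp [mul_comm]
    simp only [smul_eq_mul]
    rw [h1, hexp, hfour]
    linear_combination (Complex.exp (-((∑ j, x j * η j : ℝ) * Complex.I)) *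
      𝓕⁻ g ((2 * Real.pi)⁻¹ • x)) * h0
  have hpi : (2 * Real.pi)⁻¹ ≠ 0 := by positivity
  have hFc : Continuous (𝓕⁻ g) := by
    have h1 : Continuous (𝓕 g) :=
      VectorFourier.fourierIntegral_continuous Real.continuous_fourierChar
        (by exact continuous_inner) hgi
    have h2 : 𝓕⁻ g = fun w => 𝓕 g (-w) := by
      ext w; exact Real.fourierInv_eq_fourier_neg g w
    rw [h2]; exact h1.comp continuous_neg
  have hI : Integrable
      (fun x : Ed d => Complex.exp (-∑ j, l j * (x j : ℂ)) * fLam d φ lam0 x) := by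
    obtain ⟨C, r, hr, hC⟩ := fLam_bound hφ hlam0 hl
    refine ((integrable_exp_neg_norm d r hr).const_mul C).mono' ?_ (ae_of_all _ fun x => ?_)
    · simp only [hint]
      refine Continuous.aestronglyMeasurable ?_
      fun_prop
    · refine le_trans (le_of_eq ?_) (hC x)
      rw [norm_mul, Complex.norm_exp]
      congr 2
      simp [b, rePart]
  refine ⟨hI, ?_⟩
  let H : Ed d → ℂ :=
    fun y => Complex.exp (((-2 * Real.pi * inner ℝ y η : ℝ) : ℂ) * Complex.I) • 𝓕⁻ g y
  have hint' : (fun x : Ed d => Complex.exp (-∑ j, l j * (x j : ℂ)) * fLam d φ lam0 x)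
      = fun x => H ((2 * Real.pi)⁻¹ • x) := funext hint
  rw [hint'] at hI ⊢
  have hI2 : Integrable H := (integrable_comp_smul_iff volume H hpi).1 hI
  have hFi : Integrable (𝓕⁻ g) := by
    refine hI2.norm.mono' hFc.aestronglyMeasurable (ae_of_all _ fun y => ?_)
    simp only [H]
    rw [norm_smul, Complex.norm_exp_ofReal_mul_I, one_mul]
  have hFi' : Integrable (𝓕 g) := by
    have h2 : 𝓕 g = fun w => 𝓕⁻ g (-w) := by
      ext w; rw [Real.fourierInv_eq_fourier_neg, neg_neg]
    rw [h2]; exact hFi.comp_neg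
  have hinv : 𝓕 (𝓕⁻ g) η = g η := congrFun (hgc.fourier_fourierInv_eq hgi hFi') η
  have hgη : g η = φ l := by simp only [g, b, η, shift_re_im]
  rw [Measure.integral_comp_smul, ← hgη, ← hinv, Real.fourier_eq']
  rw [finrank_euclideanSpace_fin, abs_of_pos (by positivity), Complex.real_smul, ← mul_assoc]
  have hone : (2 * Real.pi : ℂ) ^ (-(d : ℤ)) * (((((2 * Real.pi)⁻¹) ^ d)⁻¹ : ℝ) : ℂ) = 1 := by
    have : (2 * Real.pi : ℂ) ≠ 0 := by
      have := Real.pi_ne_zero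
      simp [this]
    rw [inv_pow, inv_inv, zpow_neg, zpow_natCast]
    push_cast
    exact inv_mul_cancel₀ (pow_ne_zero _ this)
  rw [hone, one_mul]
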